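/- Let [e_1,…,e_s] be a core with s ≥ 2. Then [e_1,…,e_s] is minimal if and only if one of the following holds: (i) s is a prime number and it is not the case that e_s = e_1 and e_i = e_1 − 1 for all 2 ≤ i ≤ s−1; or (ii) s is not prime and for every factorization s = u·r with u > 1 and 1 < r < s, at least one of the following holds: there exist 2 ≤ i ≤ r−1 and 1 ≤ j ≤ u−1 with e_{i+jr} ≠ e_i, or there exists 1 ≤ j ≤ u−1 with e_{1+jr} ≠ e_1 − 1, or there exists 1 ≤ j ≤ u−1 with e_{jr} ≠ e_s − 1. -/

import Mathlib

/-- `chainSeq L k` consists of `k+1` consecutive copies of `L` separated by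
`k` single entries equal to `1`. -/
def chainSeq (L : List ℤ) : ℕ → List ℤ
  | 0 => L
  | (k + 1) => chainSeq L k ++ 1 :: L

/-- A core is a finite sequence `[e₁,…,eₛ]` of integers with all `eᵢ ≥ 2` such
that either `s = 1` and `e₁ ≥ 4`, or `s ≥ 2`, `e₁ ≥ 3` and `eₛ ≥ 3`. -/
def IsCore (E : List ℤ) : Prop :=
  (∀ e ∈ E, 2 ≤ e) ∧
    ((E.length = 1 ∧ 4 ≤ E.headI) ∨ (2 ≤ E.length ∧ 3 ≤ E.headI ∧ 3 ≤ E.getLast!))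

/-- A single contraction of an entry equal to `1`: a consecutive triple
`(x, 1, y)` is replaced by the pair `(x−1, y−1)`. -/
def ContractStep (L L' : List ℤ) : Prop :=
  ∃ (p s : List ℤ) (x y : ℤ),
    L = p ++ x :: 1 :: y :: s ∧ L' = p ++ (x - 1) :: (y - 1) :: s

/-- `ContractIter k L L'` means `L'` is obtained from `L` by `k` contractions
of entries equal to `1`, performed one at a time. -/
def ContractIter : ℕ → List ℤ → List ℤ → Prop
  | 0 => fun L L' => L = L'
  | (k + 1) => fun L L' => ∃ M, ContractStep L M ∧ ContractIter k M L'

/-- A core is minimal if there do not exist a core `[b₁,…,b_r]` and `k ≥ 1`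
such that the given core equals the sequence obtained from the chain of `k+1`
consecutive copies of `(b₁,…,b_r)` separated by `k` single entries equal to `1`
by contracting the `k` inserted entries equal to `1` one at a time. -/
def MinimalCore (E : List ℤ) : Prop :=
  IsCore E ∧
    ¬ ∃ (b : List ℤ) (k : ℕ), IsCore b ∧ 1 ≤ k ∧ ContractIter k (chainSeq b k) E

namespace CoreAux

/-- Reduction of all ones at once; `c` is the amount to subtract from the first entry. -/
def red : ℤ → List ℤ → List ℤ
  | _, [] => []
  | c, x :: xs =>
    if x = 1 then red 1 xs
    else (x - c - (if xs.head? = some 1 then 1 else 0)) :: red 0 xs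

/-- Every entry other than `1` stays at least `2` after reduction; ones are isolated. -/
def Good : ℤ → List ℤ → Prop
  | _, [] => True
  | c, x :: xs =>
    if x = 1 then c = 0 ∧ Good 1 xs
    else 2 ≤ x - c - (if xs.head? = some 1 then 1 else 0) ∧ Good 0 xs

lemma step_aux (p s : List ℤ) (x y c : ℤ) (hc : c = 0 ∨ c = 1)
    (h : Good c (p ++ x :: 1 :: y :: s)) :
    Good c (p ++ (x - 1) :: (y - 1) :: s) ∧
    red c (p ++ x :: 1 :: y :: s) = red c (p ++ (x - 1) :: (y - 1) :: s) ∧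
    (p ++ x :: 1 :: y :: s).count 1 = (p ++ (x - 1) :: (y - 1) :: s).count 1 + 1 := by
  induction p generalizing c with
  | nil =>
    simp only [List.nil_append, Good, red, List.head?_cons, List.count_cons] at h ⊢
    by_cases hx : x = 1
    · simp [hx] at h
    · by_cases hy : y = 1
      · simp [hx, hy] at h
      · simp only [hx, hy, if_true, if_false] at h
        obtain ⟨h1, -, h2, h3⟩ := h
        have : 0 ≤ (if s.head? = some 1 then (1 : ℤ) else 0) := by split_ifs <;> simp
        have e1 : x - 1 ≠ 1 := by rcases hc with rfl | rfl <;> omega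
        have e2 : y - 1 ≠ 1 := by omega
        have e3 : (some (y - 1) = some (1 : ℤ)) = False := by simp [e2]
        simp only [hx, hy, e1, e2, e3, if_true, if_false]
        refine ⟨⟨by omega, by omega, h3⟩, ?_, by simp [e1, e2, hx, hy]⟩
        congr 1
        · ring
        · congr 1; ring
  | cons a p ih =>
    have hh : (p ++ x :: 1 :: y :: s).head? = some 1 → False ∨ p ≠ [] ∨ x = 1 := by
      cases p <;> simp
    simp only [List.cons_append, Good, red, List.count_cons] at h ⊢
    by_cases ha : a = 1
    · simp only [ha, if_true] at h ⊢
      obtain ⟨i1, i2, i3⟩ := ih 1 (Or.inr rfl) h.2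
      exact ⟨⟨h.1, i1⟩, i2, by simp [i3]⟩
    · simp only [ha, if_false] at h ⊢
      obtain ⟨i1, i2, i3⟩ := ih 0 (Or.inl rfl) h.2
      have key : ((p ++ x :: 1 :: y :: s).head? = some 1) =
          ((p ++ (x - 1) :: (y - 1) :: s).head? = some 1) := by
        cases p with
        | cons q p => simp
        | nil =>
          have h2 := h.2
          simp only [List.nil_append, Good, List.head?_cons] at h2
          by_cases hx : x = 1
          · simp [hx] at h2
          · simp only [hx, if_true, if_false] at h2
            have : x - 1 ≠ 1 := by omega
            simp [hx, this]
      simp only [key] at h ⊢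
      refine ⟨⟨h.1, i1⟩, by rw [i2], by simp [i3, ha]⟩

lemma red_of_count (L : List ℤ) (h : L.count 1 = 0) : red 0 L = L := by
  induction L with
  | nil => rfl
  | cons x xs ih =>
    have hm : (1 : ℤ) ∉ x :: xs := by simpa [List.count_eq_zero] using h
    have hx : x ≠ 1 := fun e => hm (by simp [e])
    have hxs : (1 : ℤ) ∉ xs := fun e => hm (by simp [e])
    have : xs.head? ≠ some 1 := fun e => hxs (List.mem_of_head? e)
    simp [red, hx, this, ih (List.count_eq_zero.2 hxs)]

lemma iter_red (k : ℕ) (L E : List ℤ) (hg : Good 0 L) (hc : L.count 1 = k)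
    (h : ContractIter k L E) : E = red 0 L := by
  induction k generalizing L with
  | zero => rw [red_of_count L hc]; exact h.symm
  | succ k ih =>
    obtain ⟨M, ⟨p, s, x, y, rfl, rfl⟩, hM⟩ := h
    obtain ⟨i1, i2, i3⟩ := step_aux p s x y 0 (Or.inl rfl) hg
    rw [i2]
    exact ih _ i1 (by omega) hM

lemma chain_left (b : List ℤ) (k : ℕ) : chainSeq b (k + 1) = b ++ 1 :: chainSeq b k := by
  induction k with
  | zero => rfl
  | succ k ih =>
    have e : chainSeq b (k + 1 + 1) = chainSeq b (k + 1) ++ 1 :: b := rfl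
    rw [e, ih, List.append_assoc, List.cons_append, ← ih]
    rfl

lemma good_mid (L T : List ℤ) (h : ∀ e ∈ L, 2 ≤ e) (hl : ∀ z, L.getLast? = some z → 3 ≤ z)
    (hT : Good 1 T) : Good 0 (L ++ 1 :: T) := by
  induction L with
  | nil => simpa [Good] using hT
  | cons x L ih =>
    have hx := h x (by simp)
    have hx1 : x ≠ 1 := by omega
    simp only [List.cons_append, Good, hx1, if_false]
    cases L with
    | nil =>
      have := hl x (by simp)
      refine ⟨by simp; omega, by simpa [Good] using hT⟩
    | cons y L =>
      have hy := h y (by simp)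
      have : y ≠ 1 := by omega
      refine ⟨by simp [this]; omega, ih (fun e he => h e (by simp [he])) ?_⟩
      intro z hz
      exact hl z (by simpa using hz)

lemma good_end (L : List ℤ) (h : ∀ e ∈ L, 2 ≤ e) : Good 0 L := by
  induction L with
  | nil => trivial
  | cons x L ih =>
    have hx := h x (by simp)
    have hx1 : x ≠ 1 := by omega
    simp only [Good, hx1, if_false]
    have : L.head? ≠ some 1 := by
      intro e
      have := h 1 (by simp [List.mem_of_head? e])
      omega
    exact ⟨by simp [this]; omega, ih (fun e he => h e (by simp [he]))⟩

lemma good_weak (L : List ℤ) (h : Good 1 L) : Good 0 L := by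
  cases L with
  | nil => trivial
  | cons x L =>
    simp only [Good] at h ⊢
    by_cases hx : x = 1
    · simp [hx] at h
    · simp only [hx, if_false] at h ⊢
      exact ⟨by omega, h.2⟩

lemma core_iff (E : List ℤ) : IsCore E ↔ (∀ e ∈ E, 2 ≤ e) ∧
    ((E.length = 1 ∧ 4 ≤ E.getD 0 0) ∨
      (2 ≤ E.length ∧ 3 ≤ E.getD 0 0 ∧ 3 ≤ E.getD (E.length - 1) 0)) := by
  have h1 : E.headI = E.getD 0 0 := by cases E <;> rfl
  have h2 : 2 ≤ E.length → E.getLast! = E.getD (E.length - 1) 0 := by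
    intro h
    have : E ≠ [] := by rintro rfl; simp at h
    rw [List.getLast!_of_getLast? (List.getLast?_eq_getLast_of_ne_nil this), List.getLast_eq_getElem]
    rw [List.getD_eq_getElem _ _ (by omega)]
  unfold IsCore
  rw [h1]
  constructor
  · rintro ⟨h, h' | h'⟩
    · exact ⟨h, Or.inl h'⟩
    · exact ⟨h, Or.inr (by rw [← h2 h'.1]; exact h')⟩
  · rintro ⟨h, h' | h'⟩
    · exact ⟨h, Or.inl h'⟩
    · exact ⟨h, Or.inr (by rw [h2 h'.1]; exact h')⟩

lemma good_chain (b : List ℤ) (hb : IsCore b) (k : ℕ) : Good 1 (chainSeq b k) := by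
  rw [core_iff] at hb
  obtain ⟨hall, hends⟩ := hb
  cases b with
  | nil => simp at hends
  | cons x L =>
    have hx := hall x (by simp)
    have hx1 : x ≠ 1 := by omega
    have hx3 : 3 ≤ x := by
      rcases hends with h | h
      · have := h.2; simp at this; omega
      · simpa using h.2.1
    have hL : ∀ e ∈ L, 2 ≤ e := fun e he => hall e (by simp [he])
    induction k with
    | zero =>
      simp only [chainSeq, Good, hx1, if_false]
      have : L.head? ≠ some 1 := by
        intro e
        have := hL 1 (List.mem_of_head? e)
        omega
      exact ⟨by simp [this]; omega, good_end L hL⟩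
    | succ k ih =>
      rw [chain_left]
      simp only [List.cons_append, Good, hx1, if_false]
      constructor
      · cases L with
        | nil =>
          simp at hends
          simp; omega
        | cons y L =>
          have := hL y (by simp)
          have : y ≠ 1 := by omega
          simp [this]; omega
      · refine good_mid L _ hL ?_ ih
        intro z hz
        cases L with
        | nil => simp at hz
        | cons y L =>
          simp [List.getLast?_cons] at hz
          simp at hends
          have h3 := hends.2
          rw [← hz]
          rcases List.eq_nil_or_concat L with rfl | ⟨M, w, rfl⟩
          · simpa using h3
          · simpa using h3

lemma count_chain (b : List ℤ) (hb : IsCore b) (k : ℕ) : (chainSeq b k).count 1 = k := by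
  have h0 : b.count 1 = 0 := by
    rw [List.count_eq_zero]
    intro h
    have := hb.1 1 h
    omega
  induction k with
  | zero => exact h0
  | succ k ih => simp [chainSeq, ih, h0]

/-- The explicit result of contracting the chain. -/
def glue (b : List ℤ) : ℕ → List ℤ
  | 0 => b
  | k + 1 => (glue b k).dropLast ++ ((glue b k).getLast! - 1) :: (b.headI - 1) :: b.tail

lemma iter_append (k : ℕ) (L M t : List ℤ) (h : ContractIter k L M) :
    ContractIter k (L ++ t) (M ++ t) := by
  induction k generalizing L with
  | zero =>
    have h' : L = M := h
    subst h'
    rfl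
  | succ k ih =>
    obtain ⟨N, ⟨p, s, x, y, rfl, rfl⟩, hM⟩ := h
    exact ⟨_, ⟨p, s ++ t, x, y, by simp, by simp⟩, ih _ hM⟩

lemma iter_snoc (k : ℕ) (L M N : List ℤ) (h : ContractIter k L M) (h' : ContractStep M N) :
    ContractIter (k + 1) L N := by
  induction k generalizing L with
  | zero =>
    have h1 : L = M := h
    subst h1
    exact ⟨N, h', rfl⟩
  | succ k ih =>
    obtain ⟨A, hA, hM⟩ := h
    exact ⟨A, hA, ih _ hM⟩

lemma glue_ne (b : List ℤ) (hb : b ≠ []) (k : ℕ) : glue b k ≠ [] := by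
  cases k <;> simp [glue, hb]

lemma iter_glue (b : List ℤ) (hb : b ≠ []) (k : ℕ) :
    ContractIter k (chainSeq b k) (glue b k) := by
  induction k with
  | zero => rfl
  | succ k ih =>
    refine iter_snoc k _ _ _ (iter_append k _ _ (1 :: b) ih) ?_
    refine ⟨(glue b k).dropLast, b.tail, (glue b k).getLast!, b.headI, ?_, rfl⟩
    have h1 := glue_ne b hb k
    obtain ⟨y, t, rfl⟩ := List.exists_cons_of_ne_nil hb
    rcases List.eq_nil_or_concat (glue (y :: t) k) with h | ⟨M, w, h⟩
    · exact absurd h h1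
    · rw [h]
      simp [List.getLast!_of_getLast?]

lemma iter_iff (b E : List ℤ) (hb : IsCore b) (k : ℕ) :
    ContractIter k (chainSeq b k) E ↔ E = glue b k := by
  have hne : b ≠ [] := by
    rintro rfl
    have := hb.2
    simp at this
  constructor
  · intro h
    have hg := good_weak _ (good_chain b hb k)
    have hc := count_chain b hb k
    rw [iter_red k _ _ hg hc h, iter_red k _ _ hg hc (iter_glue b hne k)]
  · rintro rfl
    exact iter_glue b hne k

lemma glue_length (b : List ℤ) (hb : b ≠ []) (k : ℕ) :
    (glue b k).length = (k + 1) * b.length := by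
  induction k with
  | zero => simp [glue]
  | succ k ih =>
    have h1 : 0 < (glue b k).length := List.length_pos_iff.2 (glue_ne b hb k)
    have h2 : 0 < b.length := List.length_pos_iff.2 hb
    simp only [glue, List.length_append, List.length_dropLast, List.length_cons, List.length_tail]
    have : (k + 1 + 1) * b.length = (k + 1) * b.length + b.length := by ring
    omega

lemma getLast!_eq (E : List ℤ) (hb : E ≠ []) : E.getLast! = E.getD (E.length - 1) 0 := by
  have : 0 < E.length := List.length_pos_iff.2 hb
  rw [List.getLast!_of_getLast? (List.getLast?_eq_getLast_of_ne_nil hb), List.getLast_eq_getElem]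
  rw [List.getD_eq_getElem _ _ (by omega)]

lemma headI_eq (E : List ℤ) : E.headI = E.getD 0 0 := by cases E <;> rfl

lemma join_getD (A b : List ℤ) (hA : A ≠ []) (hb : b ≠ []) (n : ℕ) (hn : n < A.length + b.length) :
    (A.dropLast ++ (A.getLast! - 1) :: (b.headI - 1) :: b.tail).getD n 0 =
      if n < A.length then A.getD n 0 - (if n + 1 = A.length then 1 else 0)
      else b.getD (n - A.length) 0 - (if n = A.length then 1 else 0) := by
  obtain ⟨y, t, rfl⟩ := List.exists_cons_of_ne_nil hb
  rcases List.eq_nil_or_concat A with h | ⟨M, w, rfl⟩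
  · exact absurd h hA
  · have hl : (M ++ [w]).getLast! = w := by simp [List.getLast!_of_getLast?]
    rw [List.concat_eq_append, hl]
    simp only [List.dropLast_concat, List.headI, List.tail_cons, List.length_append,
      List.length_cons, List.length_nil]
    rcases lt_trichotomy n M.length with h | h | h
    · rw [List.getD_append _ _ _ _ h, List.getD_append _ _ _ _ h]
      have : n + 1 ≠ M.length + (0 + 1) := by omega
      rw [if_pos (by omega), if_neg this, sub_zero]
    · subst h
      rw [List.getD_append_right _ _ _ _ le_rfl, List.getD_append_right _ _ _ _ le_rfl]
      simp
    · rw [List.getD_append_right _ _ _ _ h.le]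
      obtain ⟨d, rfl⟩ := Nat.exists_eq_add_of_lt h
      have e1 : M.length + d + 1 - M.length = d + 1 := by omega
      have e2 : M.length + d + 1 - (M.length + (0 + 1)) = d := by omega
      have e3 : ¬ (M.length + d + 1 < M.length + (0 + 1)) := by omega
      rw [e1, e2, if_neg e3]
      cases d with
      | zero => simp
      | succ d => simp

lemma glue_getD (b : List ℤ) (hb : b ≠ []) (k i j : ℕ) (hj : j ≤ k) (hi : i < b.length) :
    (glue b k).getD (i + j * b.length) 0 =
      b.getD i 0 - (if i = 0 ∧ j ≠ 0 then 1 else 0)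
        - (if i + 1 = b.length ∧ j ≠ k then 1 else 0) := by
  induction k with
  | zero =>
    obtain rfl : j = 0 := by omega
    simp [glue]
  | succ k ih =>
    have hlen := glue_length b hb k
    rw [glue, join_getD _ _ (glue_ne b hb k) hb]
    · rcases Nat.lt_or_ge k j with h | h
      · obtain rfl : j = k + 1 := by omega
        have e1 : ¬ (i + (k + 1) * b.length < (glue b k).length) := by omega
        have e2 : i + (k + 1) * b.length - (glue b k).length = i := by omega
        have e3 : (i + (k + 1) * b.length = (glue b k).length) ↔ i = 0 := by omega
        rw [if_neg e1, e2]
        simp [e3]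
      · have hle : (j + 1) * b.length ≤ (k + 1) * b.length := Nat.mul_le_mul_right _ (by omega)
        have hx : (j + 1) * b.length = j * b.length + b.length := by ring
        have e1 : (i + j * b.length < (glue b k).length) := by omega
        have hjk : j ≠ k + 1 := by omega
        have e3 : (i + j * b.length + 1 = (glue b k).length) ↔ (i + 1 = b.length ∧ j = k) := by
          constructor
          · intro h'
            have : j = k := by
              by_contra hne
              have : (j + 1 + 1) * b.length ≤ (k + 1) * b.length :=
                Nat.mul_le_mul_right _ (by omega)
              have hx' : (j + 1 + 1) * b.length = j * b.length + b.length + b.length := by ring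
              omega
            subst this
            exact ⟨by omega, rfl⟩
          · rintro ⟨h1, rfl⟩; omega
        rw [if_pos e1, ih h]
        simp only [e3]
        by_cases ha : i + 1 = b.length <;> by_cases hk : j = k <;> simp [ha, hk, hjk]
    · have hle : (j + 1) * b.length ≤ (k + 1 + 1) * b.length := Nat.mul_le_mul_right _ (by omega)
      have hx : (j + 1) * b.length = j * b.length + b.length := by ring
      have hx' : (k + 1 + 1) * b.length = (k + 1) * b.length + b.length := by ring
      omega

lemma eq_glue (E b : List ℤ) (hb : b ≠ []) (k : ℕ) (hl : E.length = (k + 1) * b.length)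
    (h : ∀ i j, j ≤ k → i < b.length → E.getD (i + j * b.length) 0 =
      b.getD i 0 - (if i = 0 ∧ j ≠ 0 then 1 else 0)
        - (if i + 1 = b.length ∧ j ≠ k then 1 else 0)) : E = glue b k := by
  have hr : 0 < b.length := List.length_pos_iff.2 hb
  have hlg := glue_length b hb k
  refine List.ext_getElem (by omega) fun n h1 h2 => ?_
  rw [← List.getD_eq_getElem _ 0 h1, ← List.getD_eq_getElem _ 0 h2]
  have hn : n = n % b.length + (n / b.length) * b.length := (Nat.mod_add_div' n _).symm
  have hi := Nat.mod_lt n hr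
  have hj : n / b.length ≤ k := by
    have : n / b.length < k + 1 := by
      rw [Nat.div_lt_iff_lt_mul hr]; omega
    omega
  rw [hn, h _ _ hj hi, glue_getD b hb k _ _ hj hi]

end CoreAux

open CoreAux

theorem stmt11 (E : List ℤ) (hE : IsCore E) (s : ℕ) (hs : E.length = s)
    (h2 : 2 ≤ s) :
    MinimalCore E ↔
      ((s.Prime ∧ ¬ (E.getLast! = E.headI ∧
          ∀ i : ℕ, 2 ≤ i → i ≤ s - 1 → E.getD (i - 1) 0 = E.headI - 1)) ∨
       (¬ s.Prime ∧ ∀ u r : ℕ, s = u * r → 1 < u → 1 < r → r < s →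
          ((∃ i j : ℕ, 2 ≤ i ∧ i ≤ r - 1 ∧ 1 ≤ j ∧ j ≤ u - 1 ∧
              E.getD (i + j * r - 1) 0 ≠ E.getD (i - 1) 0) ∨
           (∃ j : ℕ, 1 ≤ j ∧ j ≤ u - 1 ∧
              E.getD (1 + j * r - 1) 0 ≠ E.headI - 1) ∨
           (∃ j : ℕ, 1 ≤ j ∧ j ≤ u - 1 ∧
              E.getD (j * r - 1) 0 ≠ E.getLast! - 1)))) := by
  have hE0 : E ≠ [] := by rintro rfl; simp at hs; omega
  have hcore := (core_iff E).1 hE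
  have hlast := getLast!_eq E hE0
  rw [headI_eq, hlast, hs]
  rw [hs] at hcore
  obtain ⟨hall, hends⟩ := hcore
  have hend : 3 ≤ E.getD 0 0 ∧ 3 ≤ E.getD (s - 1) 0 := by
    rcases hends with h | h
    · omega
    · exact h.2
  have hmem : ∀ n, n < s → 2 ≤ E.getD n 0 := by
    intro n hn
    rw [List.getD_eq_getElem _ _ (by omega)]
    exact hall _ (List.getElem_mem _)
  have hmin : MinimalCore E ↔ ¬ ∃ (b : List ℤ) (k : ℕ), IsCore b ∧ 1 ≤ k ∧ E = glue b k := by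
    unfold MinimalCore
    simp only [hE, true_and]
    apply not_congr
    constructor
    · rintro ⟨b, k, hb, hk, h⟩
      exact ⟨b, k, hb, hk, (iter_iff b E hb k).1 h⟩
    · rintro ⟨b, k, hb, hk, h⟩
      exact ⟨b, k, hb, hk, (iter_iff b E hb k).2 h⟩
  rw [hmin]
  constructor
  · intro hno
    by_cases hp : s.Prime
    · refine Or.inl ⟨hp, ?_⟩
      rintro ⟨h1, h3⟩
      apply hno
      refine ⟨[E.getD 0 0 + 1], s - 1, ?_, by omega, ?_⟩
      · rw [core_iff]
        simp only [List.mem_singleton, forall_eq, List.length_singleton, List.getD_cons_zero]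
        exact ⟨by omega, Or.inl ⟨trivial, by omega⟩⟩
      · refine eq_glue _ _ (by simp) _ (by simp; omega) ?_
        intro i j hj hi
        simp only [List.length_singleton] at hi ⊢
        obtain rfl : i = 0 := by omega
        simp only [List.getD_cons_zero, zero_add, mul_one, true_and]
        by_cases hj0 : j = 0
        · subst hj0
          have : (0 : ℕ) ≠ s - 1 := by omega
          simp [this]
        · by_cases hjs : j = s - 1
          · subst hjs
            rw [h1]; simp [hj0]
          · have := h3 (j + 1) (by omega) (by omega)
            simp only [Nat.add_sub_cancel] at this
            rw [this]; simp [hj0, hjs]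
    · refine Or.inr ⟨hp, ?_⟩
      intro u r hsr hu hr hrs
      by_contra hcon
      push Not at hcon
      obtain ⟨c1, c2, c3⟩ := hcon
      apply hno
      have hlen : (E.take (r - 1) ++ [E.getD (s - 1) 0]).length = r := by
        simp; omega
      have hget : ∀ i, i < r → (E.take (r - 1) ++ [E.getD (s - 1) 0]).getD i 0 =
          if i + 1 = r then E.getD (s - 1) 0 else E.getD i 0 := by
        intro i hi
        have hl : (E.take (r - 1)).length = r - 1 := by simp; omega
        split_ifs with h
        · rw [List.getD_append_right _ _ _ _ (by omega)]
          have : i - (E.take (r - 1)).length = 0 := by omega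
          rw [this]; rfl
        · rw [List.getD_append _ _ _ _ (by omega), List.getD_eq_getElem _ _ (by omega),
            List.getD_eq_getElem _ _ (by omega)]
          simp
      refine ⟨E.take (r - 1) ++ [E.getD (s - 1) 0], u - 1, ?_, by omega, ?_⟩
      · rw [core_iff]
        refine ⟨?_, Or.inr ?_⟩
        · intro e he
          rcases List.mem_append.1 he with h | h
          · exact hall e (List.mem_of_mem_take h)
          · rw [List.mem_singleton.1 h]; omega
        · rw [hlen, hget 0 (by omega), hget (r - 1) (by omega), if_neg (by omega),
            if_pos (by omega)]
          exact ⟨by omega, hend⟩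
      · refine eq_glue _ _ (by simp) _ ?_ ?_
        · rw [hlen, hs, hsr]; congr 1; omega
        · intro i j hj hi
          rw [hlen] at hi ⊢
          rw [hget i hi]
          by_cases hi1 : i + 1 = r
          · have hi0 : i ≠ 0 := by omega
            by_cases hju : j = u - 1
            · have : i + j * r = s - 1 := by
                have : u * r = (j + 1) * r := by congr 1; omega
                rw [hsr, this, Nat.add_mul]; omega
              rw [this]; simp [hi1, hi0, hju]
            · have := c3 (j + 1) (by omega) (by omega)
              have e : (j + 1) * r - 1 = i + j * r := by rw [Nat.add_mul]; omega
              rw [e] at this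
              rw [this]; simp [hi1, hi0, hju]
          · by_cases hi0 : i = 0
            · subst hi0
              by_cases hj0 : j = 0
              · subst hj0; simp [hi1]
              · have := c2 j (by omega) hj
                have e : 1 + j * r - 1 = 0 + j * r := by omega
                rw [e] at this
                rw [this]; simp [hi1, hj0]
            · by_cases hj0 : j = 0
              · subst hj0; simp [hi1, hi0]
              · have := c1 (i + 1) j (by omega) (by omega) (by omega) hj
                have e : i + 1 + j * r - 1 = i + j * r := by omega
                rw [e, Nat.add_sub_cancel] at this
                rw [this]; simp [hi1, hi0]
  · rintro hR ⟨b, k, hb, hk, hEg⟩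
    have hb0 : b ≠ [] := by
      rintro rfl
      have := hb.2
      simp at this
    have hr0 : 0 < b.length := List.length_pos_iff.2 hb0
    have hlen : s = (k + 1) * b.length := by rw [← hs, hEg, glue_length b hb0]
    have hval : ∀ i j, j ≤ k → i < b.length → E.getD (i + j * b.length) 0 =
        b.getD i 0 - (if i = 0 ∧ j ≠ 0 then 1 else 0)
          - (if i + 1 = b.length ∧ j ≠ k then 1 else 0) := by
      intro i j hj hi
      rw [hEg, glue_getD b hb0 k i j hj hi]
    by_cases hr1 : b.length = 1
    · rw [hr1] at hval hlen
      have hv : ∀ j, j ≤ k → E.getD j 0 = b.getD 0 0 - (if j ≠ 0 then 1 else 0)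
          - (if j ≠ k then 1 else 0) := by
        intro j hj
        have := hval 0 j hj (by omega)
        simpa using this
      have v0 : E.getD 0 0 = b.getD 0 0 - 1 := by
        rw [hv 0 (by omega)]
        have : (0 : ℕ) ≠ k := by omega
        simp [this]
      have vs : E.getD (s - 1) 0 = b.getD 0 0 - 1 := by
        have : s - 1 = k := by omega
        rw [this, hv k le_rfl]
        have : k ≠ 0 := by omega
        simp [this]
      have vm : ∀ j, 1 ≤ j → j < k → E.getD j 0 = b.getD 0 0 - 2 := by
        intro j h1 h2
        rw [hv j h2.le, if_pos (by omega), if_pos (by omega)]; ring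
      rcases hR with ⟨hp, hn⟩ | ⟨hp, hn⟩
      · apply hn
        refine ⟨by rw [v0, vs], ?_⟩
        intro i h1 h3
        rw [vm (i - 1) (by omega) (by omega), v0]; ring
      · obtain ⟨r, hrd, hr1, hrs⟩ := Nat.exists_dvd_of_not_prime2 h2 hp
        obtain ⟨u, hu⟩ := hrd
        have hu1 : 1 < u := by
          by_contra h
          have : u = 0 ∨ u = 1 := by omega
          rcases this with rfl | rfl <;> omega
        have hsu : s = u * r := by rw [hu, mul_comm]
        have bound : ∀ j, 1 ≤ j → j ≤ u - 1 → r ≤ j * r ∧ j * r + r ≤ s := by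
          intro j h1 h3
          have a1 : 1 * r ≤ j * r := Nat.mul_le_mul_right _ h1
          have a2 : (j + 1) * r ≤ u * r := Nat.mul_le_mul_right _ (by omega)
          rw [Nat.add_mul] at a2
          omega
        rcases hn u r hsu hu1 (by omega) hrs with ⟨i, j, h1, h3, h4, h5, h6⟩ | ⟨j, h4, h5, h6⟩ |
          ⟨j, h4, h5, h6⟩
        · have := bound j h4 h5
          rw [vm (i - 1) (by omega) (by omega), vm _ (by omega) (by omega)] at h6
          exact h6 rfl
        · have := bound j h4 h5
          rw [v0, vm _ (by omega) (by omega)] at h6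
          apply h6; ring
        · have := bound j h4 h5
          rw [vs, vm _ (by omega) (by omega)] at h6
          apply h6; ring
    · have hnp : ¬ s.Prime := by
        rw [hlen]; exact Nat.not_prime_mul (by omega) hr1
      have hrs : b.length < s := by
        rw [hlen, Nat.add_mul]
        have : 1 * b.length ≤ k * b.length := Nat.mul_le_mul_right _ hk
        omega
      have v0 : E.getD 0 0 = b.getD 0 0 := by
        have := hval 0 0 (by omega) hr0
        have h' : ¬ (1 = b.length) := by omega
        simpa [h'] using this
      have vs : E.getD (s - 1) 0 = b.getD (b.length - 1) 0 := by
        have := hval (b.length - 1) k le_rfl (by omega)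
        have e : b.length - 1 + k * b.length = s - 1 := by rw [hlen, Nat.add_mul]; omega
        have h' : ¬ (b.length - 1 = 0) := by omega
        rw [e] at this
        simpa [h'] using this
      rcases hR with ⟨hp, -⟩ | ⟨-, hn⟩
      · exact hnp hp
      · rcases hn (k + 1) b.length hlen (by omega) (by omega) hrs with
          ⟨i, j, h1, h3, h4, h5, h6⟩ | ⟨j, h4, h5, h6⟩ | ⟨j, h4, h5, h6⟩
        · apply h6
          have a1 := hval (i - 1) j (by omega) (by omega)
          have a2 := hval (i - 1) 0 (by omega) (by omega)
          have e : i - 1 + j * b.length = i + j * b.length - 1 := by omega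
          have n1 : ¬ (i - 1 = 0) := by omega
          have n2 : ¬ (i - 1 + 1 = b.length) := by omega
          rw [e] at a1
          simp only [n1, n2, false_and, if_false, zero_mul, add_zero] at a1 a2
          rw [a1, a2]
        · apply h6
          have a1 := hval 0 j (by omega) (by omega)
          have e : 0 + j * b.length = 1 + j * b.length - 1 := by omega
          have n1 : ¬ (0 + 1 = b.length) := by omega
          have n2 : j ≠ 0 := by omega
          rw [e] at a1
          simp only [n1, n2, false_and, if_false, ne_eq, not_false_eq_true, and_self,
            if_true] at a1
          rw [a1, v0]; ring
        · apply h6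
          have a1 := hval (b.length - 1) (j - 1) (by omega) (by omega)
          have e : b.length - 1 + (j - 1) * b.length = j * b.length - 1 := by
            obtain ⟨j', rfl⟩ : ∃ j', j = j' + 1 := ⟨j - 1, by omega⟩
            rw [Nat.add_sub_cancel, Nat.add_mul]; omega
          have n1 : ¬ (b.length - 1 = 0) := by omega
          have n2 : b.length - 1 + 1 = b.length := by omega
          have n3 : j - 1 ≠ k := by omega
          rw [e] at a1
          simp only [n1, n2, n3, false_and, if_false, ne_eq, not_false_eq_true, and_self,
            if_true] at a1
          rw [a1, vs]; ring
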